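/- Let a_l, a_r be nonnegative integers with a_l + a_r < k_d − k_c. For every integer α with −a_l ≤ α ≤ a_r, the F₂-linear span, inside F₂^N ⊕ F₂^N ⊕ F₂ (encoding X-part, Z-part, and sign bit of Pauli operators), of the set consisting of (L_α(p̃_j), 0, 0) for j = 1,…,n−k_c, of (0, M_α(p̃_j), p̃_j·O(q₁,−α)) for j = 1,…,n−k_c, and of (0, r, 0) for r ∈ R, is the same for all such α (equal to its value at α = 0). -/

import Mathlib

open Polynomial

abbrev F2 := ZMod 2

abbrev Vec (n : ℕ) := ZMod n → F2

/-- Standard dot product on `F₂`-vectors indexed by a finite type. -/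
def dot {ι : Type} [Fintype ι] (u v : ι → F2) : F2 := ∑ i, u i * v i

/-- Right cyclic shift by `α` positions (indices mod `n`). -/
def shiftR {n : ℕ} (c : Vec n) (α : ℤ) : Vec n := fun i => c (i - (α : ZMod n))

/-- Vectorization of a polynomial: `c₀+c₁x+⋯ ↦ (c₀,c₁,…,c_{n-1})`. -/
def polyVec {n : ℕ} (f : Polynomial F2) : Vec n := fun i => f.coeff i.val

/-- A binary cyclic code: a subspace of `F₂ⁿ` closed under cyclic shift. -/
def IsCyclicCode {n : ℕ} (C : Submodule F2 (Vec n)) : Prop :=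
  ∀ c ∈ C, shiftR c 1 ∈ C

/-- Dual code with respect to the standard dot product. -/
def dualCode {ι : Type} [Fintype ι] (C : Submodule F2 (ι → F2)) :
    Submodule F2 (ι → F2) where
  carrier := {w | ∀ c ∈ C, dot c w = 0}
  add_mem' := by
    intro a b ha hb c hc
    have h1 := ha c hc
    have h2 := hb c hc
    simp only [dot, Set.mem_setOf_eq, Pi.add_apply, mul_add, Finset.sum_add_distrib] at *
    rw [h1, h2, add_zero]
  zero_mem' := by
    intro c hc
    simp [dot]
  smul_mem' := by
    intro r a ha c hc
    have h := ha c hc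
    simp only [dot, Set.mem_setOf_eq, Pi.smul_apply, smul_eq_mul] at *
    calc (∑ i, c i * (r * a i)) = r * ∑ i, c i * a i := by
          rw [Finset.mul_sum]
          exact Finset.sum_congr rfl fun i _ => by ring
      _ = 0 := by rw [h, mul_zero]

/-- `g` is the generator polynomial of the cyclic code `C`: monic, divides `xⁿ−1`,
and `C` consists exactly of the vectorizations of the multiples `f·g` with
`deg f < n − deg g`. -/
structure IsGenPoly {n : ℕ} [NeZero n] (C : Submodule F2 (Vec n)) (g : Polynomial F2) :
    Prop where
  monic : g.Monic
  dvd : g ∣ (X ^ n - 1)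
  mem_iff : ∀ v : Vec n, v ∈ C ↔
    ∃ f : Polynomial F2, f.degree < ((n - g.natDegree : ℕ) : WithBot ℕ) ∧ v = polyVec (f * g)

/-- `L_α(c)`: the length-`N` vector `(last aₗ+α coords of c | c | first aᵣ−α coords of c)`;
uniformly, position `i` holds `c((i − (aₗ+α)) mod n)`. -/
def padL (al n ar : ℕ) (α : ℤ) (c : Vec n) : Fin (al + n + ar) → F2 :=
  fun i => c (((((i : ℕ) : ℤ) - ((al : ℤ) + α)) : ℤ) : ZMod n)

/-- `M_α(c)`: the length-`N` vector `(0^{aₗ+α} | c | 0^{aᵣ−α})`. -/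
def padM (al n ar : ℕ) (α : ℤ) (c : Vec n) : Fin (al + n + ar) → F2 :=
  fun i => if (al : ℤ) + α ≤ ((i : ℕ) : ℤ) ∧ ((i : ℕ) : ℤ) < (al : ℤ) + α + n
    then c (((((i : ℕ) : ℤ) - ((al : ℤ) + α)) : ℤ) : ZMod n) else 0

/-- The set `R` of ancilla stabilizer vectors (1-indexed in the paper):
`e_i + e_{n+i}` for `1 ≤ i ≤ aₗ` and `e_{aₗ+i} + e_{aₗ+n+i}` for `1 ≤ i ≤ aᵣ`. -/
def ancSet (al n ar : ℕ) : Set (Fin (al + n + ar) → F2) :=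
  (Set.range fun i : Fin al => (fun k : Fin (al + n + ar) =>
      (if (k : ℕ) = (i : ℕ) then (1 : F2) else 0) +
      (if (k : ℕ) = n + (i : ℕ) then (1 : F2) else 0))) ∪
  (Set.range fun i : Fin ar => (fun k : Fin (al + n + ar) =>
      (if (k : ℕ) = al + (i : ℕ) then (1 : F2) else 0) +
      (if (k : ℕ) = al + n + (i : ℕ) then (1 : F2) else 0)))

section CyclicShift

variable {n : ℕ}

theorem shiftR_shiftR (c : Vec n) (a b : ℤ) : shiftR (shiftR c a) b = shiftR c (a + b) := by
  funext i
  simp only [shiftR]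
  congr 1
  push_cast
  ring

theorem shiftR_zero (c : Vec n) : shiftR c 0 = c := by
  funext i
  simp [shiftR]

/-- The cyclic shift as a linear map. -/
def shiftHom (a : ℤ) : Vec n →ₗ[F2] Vec n where
  toFun c := shiftR c a
  map_add' _ _ := rfl
  map_smul' _ _ := rfl

theorem shiftHom_apply (a : ℤ) (c : Vec n) : shiftHom a c = shiftR c a := rfl

variable [NeZero n]

theorem dot_shiftR_neg (u v : Vec n) (a : ℤ) : dot u (shiftR v (-a)) = dot (shiftR u a) v := by
  unfold dot shiftR
  refine Fintype.sum_equiv (Equiv.addRight (a : ZMod n)) _ _ fun i => ?_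
  simp

theorem IsCyclicCode.shiftR_mem {C : Submodule F2 (Vec n)} (hC : IsCyclicCode C) {c : Vec n}
    (hc : c ∈ C) (a : ℤ) : shiftR c a ∈ C := by
  have natural (m : ℕ) : shiftR c (m : ℤ) ∈ C := by
    induction m with
    | zero => simpa [shiftR_zero] using hc
    | succ m ih =>
      have h := hC _ ih
      rw [shiftR_shiftR] at h
      exact_mod_cast h
  have h : shiftR c a = shiftR c (((a : ZMod n).val : ℕ) : ℤ) := by
    funext i
    simp [shiftR]
  rw [h]
  exact natural _

theorem IsCyclicCode.dualCode {C : Submodule F2 (Vec n)} (hC : IsCyclicCode C) :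
    IsCyclicCode (dualCode C) := by
  intro w hw c hc
  have h := dot_shiftR_neg c w (-1)
  rw [neg_neg] at h
  rw [h]
  exact hw _ (hC.shiftR_mem hc _)

theorem IsCyclicCode.map_shiftHom {C : Submodule F2 (Vec n)} (hC : IsCyclicCode C) (a : ℤ) :
    C.map (shiftHom a) = C := by
  apply le_antisymm
  · rintro _ ⟨c, hc, rfl⟩
    exact hC.shiftR_mem hc a
  · intro c hc
    refine ⟨shiftR c (-a), hC.shiftR_mem hc _, ?_⟩
    change shiftR (shiftR c (-a)) a = c
    rw [shiftR_shiftR, neg_add_cancel, shiftR_zero]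

theorem polyVec_X_pow_mul (g : Polynomial F2) (m : ℕ) (h : m + g.natDegree < n) :
    (polyVec (X ^ m * g) : Vec n) = shiftR (polyVec g) (m : ℤ) := by
  funext i
  simp only [polyVec, shiftR, Int.cast_natCast, coeff_X_pow_mul']
  have hi := ZMod.val_lt i
  have hm : (m : ZMod n).val = m := ZMod.val_cast_of_lt (by omega)
  split_ifs with hle
  · rw [ZMod.val_sub (by rwa [hm]), hm]
  · symm
    apply coeff_eq_zero_of_natDegree_lt
    have hi' : i - (m : ZMod n) = ((i.val + n - m : ℕ) : ZMod n) := by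
      rw [Nat.cast_sub (by omega)]
      simp
    rw [hi', ZMod.val_cast_of_lt (by omega)]
    omega

/-- A cyclic code is spanned by the first shifts of its generator polynomial. -/
theorem IsGenPoly.span_shiftR {C : Submodule F2 (Vec n)} {g : Polynomial F2}
    (hg : IsGenPoly C g) :
    Submodule.span F2 {v : Vec n | ∃ j : ℕ, 1 ≤ j ∧ j ≤ n - g.natDegree ∧
      v = shiftR (polyVec g) ((j : ℤ) - 1)} = C := by
  apply le_antisymm
  · rw [Submodule.span_le]
    rintro _ ⟨j, hj, hjn, rfl⟩
    obtain ⟨m, rfl⟩ := Nat.exists_eq_add_of_le' hj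
    refine (hg.mem_iff _).2 ⟨X ^ m, ?_, ?_⟩
    · rw [degree_X_pow]
      exact_mod_cast (by omega : m < n - g.natDegree)
    · rw [polyVec_X_pow_mul g m (by omega)]
      simp
  · intro v hv
    obtain ⟨f, hf, rfl⟩ := (hg.mem_iff v).1 hv
    obtain rfl | hf₀ := eq_or_ne f 0
    · convert Submodule.zero_mem _
      funext i
      simp [polyVec]
    have expand : (polyVec (f * g) : Vec n) =
        ∑ m ∈ Finset.range (n - g.natDegree), f.coeff m • (polyVec (X ^ m * g) : Vec n) := by
      have hsum : f * g = ∑ m ∈ Finset.range (n - g.natDegree), f.coeff m • (X ^ m * g) := by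
        conv_lhs => rw [f.as_sum_range' (n - g.natDegree)
          ((natDegree_lt_iff_degree_lt hf₀).2 hf), Finset.sum_mul]
        refine Finset.sum_congr rfl fun m _ => ?_
        rw [← smul_X_eq_monomial, smul_mul_assoc]
      funext i
      rw [hsum]
      simp [polyVec]
    rw [expand]
    refine Submodule.sum_mem _ fun m hm => Submodule.smul_mem _ _ (Submodule.subset_span ?_)
    have hm' := Finset.mem_range.1 hm
    refine ⟨m + 1, by omega, by omega, ?_⟩
    rw [polyVec_X_pow_mul g m (by omega)]
    simp

end CyclicShift

section Padding

variable (al n ar : ℕ)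

/-- The `n`-periodic extension of `u`, restricted to positions `s, …, s + n - 1`. -/
def window (u : Vec n) (s : ℕ) : Fin (al + n + ar) → F2 :=
  fun i => if s ≤ (i : ℕ) ∧ (i : ℕ) < s + n then u ((i : ℕ) : ZMod n) else 0

theorem ancilla_mem_ancSet {s : ℕ} (hs : s < al + ar) :
    (fun k : Fin (al + n + ar) => (if (k : ℕ) = s then (1 : F2) else 0) +
      (if (k : ℕ) = n + s then (1 : F2) else 0)) ∈ ancSet al n ar := by
  by_cases h : s < al
  · exact Or.inl ⟨⟨s, h⟩, rfl⟩
  · refine Or.inr ⟨⟨s - al, by omega⟩, ?_⟩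
    funext k
    have h₁ : al + (s - al) = s := by omega
    have h₂ : al + n + (s - al) = n + s := by omega
    simp only [h₁, h₂]

theorem padM_eq_window (c : Vec n) (α : ℤ) {s : ℕ} (hs : (s : ℤ) = al + α) :
    padM al n ar α c = window al n ar (shiftR c s) s := by
  funext i
  simp only [padM, window, ← hs, shiftR]
  norm_cast

theorem padL_eq_padL_shiftR (c : Vec n) (α : ℤ) :
    padL al n ar α c = padL al n ar 0 (shiftR c α) := by
  funext i
  simp only [padL, shiftR]
  congr 1
  push_cast
  ring

variable [NeZero n]

theorem window_succ_sub_window (u : Vec n) (s : ℕ) :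
    window al n ar u (s + 1) - window al n ar u s =
      u (s : ZMod n) • fun k : Fin (al + n + ar) => (if (k : ℕ) = s then (1 : F2) else 0) +
        (if (k : ℕ) = n + s then (1 : F2) else 0) := by
  have hn := NeZero.pos n
  funext k
  simp only [window, Pi.sub_apply, Pi.smul_apply, smul_eq_mul]
  by_cases h₁ : (k : ℕ) = s
  · rw [if_neg (by omega), if_pos (by omega), if_pos h₁, if_neg (by omega), h₁]
    simp [ZModModule.neg_eq_self]
  by_cases h₂ : (k : ℕ) = n + s
  · rw [if_pos (by omega), if_neg (by omega), if_neg h₁, if_pos h₂, h₂]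
    simp
  rw [if_neg h₁, if_neg h₂]
  split_ifs <;> first | omega | simp

theorem window_sub_window_zero_mem (u : Vec n) {s : ℕ} (hs : s ≤ al + ar) :
    window al n ar u s - window al n ar u 0 ∈ Submodule.span F2 (ancSet al n ar) := by
  induction s with
  | zero => simp
  | succ s ih =>
    rw [← sub_add_sub_cancel _ (window al n ar u s), window_succ_sub_window]
    exact add_mem (Submodule.smul_mem _ _ (Submodule.subset_span
      (ancilla_mem_ancSet al n ar (by omega)))) (ih (by omega))

/-- Moving the window of `padM` changes the padded vector by ancilla vectors only. -/
theorem padM_sub_padM_shiftR_mem (c : Vec n) {α : ℤ} (hα₁ : -(al : ℤ) ≤ α)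
    (hα₂ : α ≤ (ar : ℤ)) :
    padM al n ar α c - padM al n ar 0 (shiftR c α) ∈ Submodule.span F2 (ancSet al n ar) := by
  obtain ⟨s, hs⟩ := Int.eq_ofNat_of_zero_le (by omega : 0 ≤ (al : ℤ) + α)
  rw [padM_eq_window al n ar c α hs.symm,
    padM_eq_window al n ar _ 0 (s := al) (by simp), shiftR_shiftR, add_comm α, hs,
    ← sub_sub_sub_cancel_right _ _ (window al n ar (shiftR c s) 0)]
  exact sub_mem (window_sub_window_zero_mem al n ar _ (by omega))
    (window_sub_window_zero_mem al n ar _ (by omega))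

/-- The `X`-type stabilizer of a codeword. -/
def stabX (α : ℤ) :
    Vec n →ₗ[F2] (Fin (al + n + ar) → F2) × (Fin (al + n + ar) → F2) × F2 where
  toFun c := (padL al n ar α c, 0, 0)
  map_add' _ _ := by ext <;> simp [padL]
  map_smul' _ _ := by ext <;> simp [padL]

/-- The `Z`-type stabilizer of a codeword, with sign given by the marker `m`. -/
def stabZ (α : ℤ) (m : Vec n) :
    Vec n →ₗ[F2] (Fin (al + n + ar) → F2) × (Fin (al + n + ar) → F2) × F2 where
  toFun c := (0, padM al n ar α c, dot c m)
  map_add' x y := by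
    ext i
    · simp
    · simp only [padM, Prod.snd_add, Prod.fst_add, Pi.add_apply]
      split_ifs <;> simp
    · simp [dot, add_mul, Finset.sum_add_distrib]
  map_smul' r x := by
    ext i
    · simp
    · simp [padM]
    · simp [dot, mul_assoc, Finset.mul_sum]

end Padding

theorem Submodule.map_sup_eq_map_sup_of_sub_mem {R V W : Type*} [Ring R] [AddCommGroup V]
    [AddCommGroup W] [Module R V] [Module R W] {K : Submodule R V} {S : Submodule R W}
    {f g : V →ₗ[R] W} (h : ∀ c ∈ K, f c - g c ∈ S) : K.map f ⊔ S = K.map g ⊔ S := by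
  have one_sided {f g : V →ₗ[R] W} (h : ∀ c ∈ K, f c - g c ∈ S) :
      K.map f ⊔ S ≤ K.map g ⊔ S := by
    refine sup_le ?_ le_sup_right
    rintro _ ⟨c, hc, rfl⟩
    rw [← add_sub_cancel (g c) (f c)]
    exact Submodule.add_mem_sup (Submodule.mem_map_of_mem hc) (h c hc)
  exact le_antisymm (one_sided h) (one_sided fun c hc => by
    rw [← neg_sub]
    exact neg_mem (h c hc))

/-- The span of the padded stabilizers in terms of the code they come from. -/
theorem span_stabilizers {n : ℕ} [NeZero n] {K : Submodule F2 (Vec n)} {g : Polynomial F2}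
    (hg : IsGenPoly K g) (al ar : ℕ) (α : ℤ) (m : Vec n) :
    Submodule.span F2
      (({ x : (Fin (al + n + ar) → F2) × (Fin (al + n + ar) → F2) × F2 |
          ∃ j : ℕ, 1 ≤ j ∧ j ≤ n - g.natDegree ∧
            x = (padL al n ar α (shiftR (polyVec g : Vec n) ((j : ℤ) - 1)), 0, 0) } ∪
        { x : (Fin (al + n + ar) → F2) × (Fin (al + n + ar) → F2) × F2 |
          ∃ j : ℕ, 1 ≤ j ∧ j ≤ n - g.natDegree ∧
            x = (0, padM al n ar α (shiftR (polyVec g : Vec n) ((j : ℤ) - 1)),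
                 dot (shiftR (polyVec g : Vec n) ((j : ℤ) - 1)) m) } ∪
        { x : (Fin (al + n + ar) → F2) × (Fin (al + n + ar) → F2) × F2 |
          ∃ r ∈ ancSet al n ar, x = (0, r, 0) })) =
      K.map (stabX al n ar α) ⊔ (K.map (stabZ al n ar α m) ⊔
        (Submodule.span F2 (ancSet al n ar)).map
          (LinearMap.inr F2 _ _ ∘ₗ LinearMap.inl F2 _ _)) := by
  rw [Submodule.span_union, Submodule.span_union, sup_assoc]
  congr 1
  · rw [← hg.span_shiftR, Submodule.map_span]
    congr 1
    ext x
    constructor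
    · rintro ⟨j, h₁, h₂, rfl⟩
      exact ⟨_, ⟨j, h₁, h₂, rfl⟩, rfl⟩
    · rintro ⟨_, ⟨j, h₁, h₂, rfl⟩, rfl⟩
      exact ⟨j, h₁, h₂, rfl⟩
  congr 1
  · rw [← hg.span_shiftR, Submodule.map_span]
    congr 1
    ext x
    constructor
    · rintro ⟨j, h₁, h₂, rfl⟩
      exact ⟨_, ⟨j, h₁, h₂, rfl⟩, rfl⟩
    · rintro ⟨_, ⟨j, h₁, h₂, rfl⟩, rfl⟩
      exact ⟨j, h₁, h₂, rfl⟩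
  · rw [Submodule.map_span]
    congr 1
    ext x
    constructor
    · rintro ⟨r, hr, rfl⟩
      exact ⟨r, hr, rfl⟩
    · rintro ⟨r, hr, rfl⟩
      exact ⟨r, hr, rfl⟩

/-- (Corollary `equiv_stab_group_QSC`.) With `aₗ + aᵣ < k_d − k_c`, for
every `α ∈ [−aₗ, aᵣ]` the span of the padded QSC stabilizer generating set (with marker
`q₁`) equals its value at `α = 0`. -/
theorem stmt9 (n kc kd : ℕ) [NeZero n] (C D : Submodule F2 (Vec n))
    (hCcyc : IsCyclicCode C) (hDcyc : IsCyclicCode D)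
    (hdimC : Module.finrank F2 C = kc) (hdimD : Module.finrank F2 D = kd)
    (hCperp : dualCode C < C) (hCD : C < D) (hkckd : kc < kd)
    (q pR : Polynomial F2)
    (hq : IsGenPoly D q) (hpR : IsGenPoly (dualCode C) pR)
    (hdegq : q.natDegree = n - kd) (hdegpR : pR.natDegree = kc)
    (al ar : ℕ) (hsum : al + ar < kd - kc)
    (α : ℤ) (hα₁ : -(al : ℤ) ≤ α) (hα₂ : α ≤ (ar : ℤ)) :
    Submodule.span F2
      (({ x : (Fin (al + n + ar) → F2) × (Fin (al + n + ar) → F2) × F2 |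
          ∃ j : ℕ, 1 ≤ j ∧ j ≤ n - kc ∧
            x = (padL al n ar α (shiftR (polyVec pR : Vec n) ((j : ℤ) - 1)), 0, 0) } ∪
        { x : (Fin (al + n + ar) → F2) × (Fin (al + n + ar) → F2) × F2 |
          ∃ j : ℕ, 1 ≤ j ∧ j ≤ n - kc ∧
            x = (0, padM al n ar α (shiftR (polyVec pR : Vec n) ((j : ℤ) - 1)),
                 dot (shiftR (polyVec pR : Vec n) ((j : ℤ) - 1))
                     (shiftR (polyVec q : Vec n) (-α))) } ∪
        { x : (Fin (al + n + ar) → F2) × (Fin (al + n + ar) → F2) × F2 |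
          ∃ r ∈ ancSet al n ar, x = (0, r, 0) }))
    = Submodule.span F2
      (({ x : (Fin (al + n + ar) → F2) × (Fin (al + n + ar) → F2) × F2 |
          ∃ j : ℕ, 1 ≤ j ∧ j ≤ n - kc ∧
            x = (padL al n ar 0 (shiftR (polyVec pR : Vec n) ((j : ℤ) - 1)), 0, 0) } ∪
        { x : (Fin (al + n + ar) → F2) × (Fin (al + n + ar) → F2) × F2 |
          ∃ j : ℕ, 1 ≤ j ∧ j ≤ n - kc ∧
            x = (0, padM al n ar 0 (shiftR (polyVec pR : Vec n) ((j : ℤ) - 1)),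
                 dot (shiftR (polyVec pR : Vec n) ((j : ℤ) - 1)) (polyVec q)) } ∪
        { x : (Fin (al + n + ar) → F2) × (Fin (al + n + ar) → F2) × F2 |
          ∃ r ∈ ancSet al n ar, x = (0, r, 0) })) := by
  subst hdegpR
  have hcyc := hCcyc.dualCode
  have hX : stabX al n ar α = stabX al n ar 0 ∘ₗ shiftHom α := by
    refine LinearMap.ext fun c => ?_
    exact congrArg (fun v => (v, 0, 0)) (padL_eq_padL_shiftR al n ar c α)
  have hZ : ∀ c ∈ dualCode C, stabZ al n ar α (shiftR (polyVec q) (-α)) c -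
      (stabZ al n ar 0 (polyVec q) ∘ₗ shiftHom α) c ∈
        (Submodule.span F2 (ancSet al n ar)).map
          (LinearMap.inr F2 (Fin (al + n + ar) → F2) _ ∘ₗ LinearMap.inl F2 _ F2) := by
    intro c _
    refine ⟨_, padM_sub_padM_shiftR_mem al n ar c hα₁ hα₂, ?_⟩
    simp [stabZ, shiftHom_apply, dot_shiftR_neg]
  rw [span_stabilizers hpR, span_stabilizers hpR, Submodule.map_sup_eq_map_sup_of_sub_mem hZ, hX,
    Submodule.map_comp, Submodule.map_comp, hcyc.map_shiftHom]
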